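/- Let p be a prime and let 0 ≤ a ≤ b be integers. The number of orbits of Aut(G) acting componentwise on the set of generating pairs of G = ℤ_{p^a} ⊕ ℤ_{p^b} equals ψ(p^{b−a}), the Dedekind totient; explicitly, it equals 1 if a = b and equals p^{b−a} + p^{b−a−1} if a < b. -/

import Mathlib

/-- The integer relations satisfied by a pair of elements of an additive group. -/
def pairRelations {G : Type*} [AddCommGroup G] (x y : G) : Set (ℤ × ℤ) :=
  {v | v.1 • x + v.2 • y = 0}

theorem exists_addAut_iff_pairRelations_eq {G : Type*} [AddCommGroup G] {x y x' y' : G}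
    (h : AddSubgroup.closure ({x, y} : Set G) = ⊤)
    (h' : AddSubgroup.closure ({x', y'} : Set G) = ⊤) :
    (∃ σ : AddAut G, σ x = x' ∧ σ y = y') ↔ pairRelations x y = pairRelations x' y' := by
  constructor
  · rintro ⟨σ, rfl, rfl⟩
    ext v
    simp only [pairRelations, Set.mem_ofPred_eq]
    rw [← map_zsmul σ, ← map_zsmul σ, ← map_add σ]
    exact (EmbeddingLike.map_eq_zero_iff (f := σ)).symm
  · intro hK
    let F : G → G → (ℤ × ℤ →+ G) := fun u v =>
      (zmultiplesHom G u).coprod (zmultiplesHom G v)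
    have hF : ∀ u v w, F u v w = w.1 • u + w.2 • v := fun u v w => by
      simp [F, AddMonoidHom.coprod_apply]
    have surj : ∀ u v : G, AddSubgroup.closure ({u, v} : Set G) = ⊤ →
        Function.Surjective (F u v) := by
      intro u v huv z
      have hz : z ∈ AddSubgroup.closure ({u, v} : Set G) := huv ▸ AddSubgroup.mem_top z
      obtain ⟨m, k, hmk⟩ := AddSubgroup.mem_closure_pair.1 hz
      exact ⟨(m, k), by rw [hF, hmk]⟩
    have hker : (F x y).ker = (F x' y').ker := by
      ext v
      rw [AddMonoidHom.mem_ker, AddMonoidHom.mem_ker, hF, hF]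
      exact Set.ext_iff.1 hK v
    let e := QuotientAddGroup.quotientKerEquivOfSurjective (F x y) (surj x y h)
    let e' := QuotientAddGroup.quotientKerEquivOfSurjective (F x' y') (surj x' y' h')
    let σ : AddAut G := (e.symm.trans (QuotientAddGroup.quotientAddEquivOfEq hker)).trans e'
    have hσ : ∀ w, σ (F x y w) = F x' y' w := by
      intro w
      have : e.symm (F x y w) = (w : (ℤ × ℤ) ⧸ (F x y).ker) := by
        rw [AddEquiv.symm_apply_eq]; rfl
      change e' (QuotientAddGroup.quotientAddEquivOfEq hker (e.symm (F x y w))) = _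
      rw [this]
      rfl
    refine ⟨σ, ?_, ?_⟩
    · simpa [hF] using hσ (1, 0)
    · simpa [hF] using hσ (0, 1)

section Relations

variable {p a b : ℕ} {x y : ZMod (p ^ a) × ZMod (p ^ b)}

theorem exists_intCast_pair (x : ZMod (p ^ a) × ZMod (p ^ b)) :
    ∃ m n : ℤ, x = ((m : ZMod (p ^ a)), (n : ZMod (p ^ b))) := by
  obtain ⟨m, hm⟩ := ZMod.intCast_surjective x.1
  obtain ⟨n, hn⟩ := ZMod.intCast_surjective x.2
  exact ⟨m, n, Prod.ext hm.symm hn.symm⟩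

theorem zsmul_add_zsmul_intCast_eq_iff {m k X₁ X₂ Y₁ Y₂ Z₁ Z₂ : ℤ} :
    m • ((X₁ : ZMod (p ^ a)), (X₂ : ZMod (p ^ b))) +
      k • ((Y₁ : ZMod (p ^ a)), (Y₂ : ZMod (p ^ b))) = ((Z₁ : ZMod (p ^ a)), (Z₂ : ZMod (p ^ b)))
      ↔ (p ^ a : ℤ) ∣ m * X₁ + k * Y₁ - Z₁ ∧ (p ^ b : ℤ) ∣ m * X₂ + k * Y₂ - Z₂ := by
  have key : ∀ (c : ℕ) (M N : ℤ), (M : ZMod (p ^ c)) = N ↔ (p ^ c : ℤ) ∣ M - N := by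
    intro c M N
    rw [← sub_eq_zero, ← Int.cast_sub, ZMod.intCast_zmod_eq_zero_iff_dvd]
    push_cast
    rfl
  rw [← key, ← key, Prod.ext_iff]
  simp

/-- The relations of a generating pair of `ℤ_{p^a} ⊕ ℤ_{p^b}` are `p ^ a` times the relations of
its second coordinates modulo `p ^ (b - a)`. -/
theorem mem_pairRelations_iff (hab : a ≤ b) {X₁ X₂ Y₁ Y₂ : ℤ}
    (h : AddSubgroup.closure ({((X₁ : ZMod (p ^ a)), (X₂ : ZMod (p ^ b))),
      ((Y₁ : ZMod (p ^ a)), (Y₂ : ZMod (p ^ b)))} : Set (ZMod (p ^ a) × ZMod (p ^ b))) = ⊤)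
    (m k : ℤ) :
    (m, k) ∈ pairRelations ((X₁ : ZMod (p ^ a)), (X₂ : ZMod (p ^ b)))
        ((Y₁ : ZMod (p ^ a)), (Y₂ : ZMod (p ^ b))) ↔
      ∃ m' k' : ℤ, m = p ^ a * m' ∧ k = p ^ a * k' ∧ (p ^ (b - a) : ℤ) ∣ m' * X₂ + k' * Y₂ := by
  have hpow : (p : ℤ) ^ b = p ^ a * p ^ (b - a) := by rw [← pow_add, Nat.add_sub_cancel' hab]
  have hzero : (m, k) ∈ pairRelations ((X₁ : ZMod (p ^ a)), (X₂ : ZMod (p ^ b)))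
        ((Y₁ : ZMod (p ^ a)), (Y₂ : ZMod (p ^ b))) ↔
      (p ^ a : ℤ) ∣ m * X₁ + k * Y₁ ∧ (p ^ b : ℤ) ∣ m * X₂ + k * Y₂ := by
    have := zsmul_add_zsmul_intCast_eq_iff (p := p) (a := a) (b := b) (m := m) (k := k)
      (X₁ := X₁) (X₂ := X₂) (Y₁ := Y₁) (Y₂ := Y₂) (Z₁ := 0) (Z₂ := 0)
    simpa [pairRelations] using this
  rw [hzero]
  constructor
  · rintro ⟨h₁, h₂⟩
    have gen : ∀ Z₁ Z₂ : ℤ, ∃ u v : ℤ, (p ^ a : ℤ) ∣ u * X₁ + v * Y₁ - Z₁ ∧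
        (p ^ a : ℤ) ∣ u * X₂ + v * Y₂ - Z₂ := by
      intro Z₁ Z₂
      have hz := h ▸ AddSubgroup.mem_top ((Z₁ : ZMod (p ^ a)), (Z₂ : ZMod (p ^ b)))
      obtain ⟨u, v, huv⟩ := AddSubgroup.mem_closure_pair.1 hz
      obtain ⟨d₁, d₂⟩ := zsmul_add_zsmul_intCast_eq_iff.1 huv
      exact ⟨u, v, d₁, (Dvd.intro _ hpow.symm).trans d₂⟩
    obtain ⟨α, β, ⟨c₁, e₁⟩, ⟨c₂, e₂⟩⟩ := gen 1 0
    obtain ⟨γ, δ, ⟨c₃, e₃⟩, ⟨c₄, e₄⟩⟩ := gen 0 1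
    obtain ⟨c₅, e₅⟩ := h₁
    obtain ⟨c₆, e₆⟩ := (Dvd.intro _ hpow.symm : (p ^ a : ℤ) ∣ p ^ b).trans h₂
    have hdet : (p ^ a : ℤ) ∣ (α * δ - β * γ) * (X₁ * Y₂ - X₂ * Y₁) - 1 := by
      have : (α * δ - β * γ) * (X₁ * Y₂ - X₂ * Y₁) - 1 =
          (α * X₁ + β * Y₁ - 1) * (γ * X₂ + δ * Y₂ - 1) + (α * X₁ + β * Y₁ - 1)
          + (γ * X₂ + δ * Y₂ - 1) - (α * X₂ + β * Y₂ - 0) * (γ * X₁ + δ * Y₁ - 0) := by ring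
      rw [this, e₁, e₂, e₃, e₄]
      exact ⟨c₁ * (p ^ a * c₄) + c₁ + c₄ - c₂ * (p ^ a * c₃), by ring⟩
    obtain ⟨c, hc⟩ := hdet
    set D := α * δ - β * γ with hD
    have hm : m = p ^ a * (D * (Y₂ * c₅ - Y₁ * c₆) - m * c) := by
      linear_combination (-m) * hc + D * Y₂ * e₅ - D * Y₁ * e₆
    have hk : k = p ^ a * (D * (X₁ * c₆ - X₂ * c₅) - k * c) := by
      linear_combination (-k) * hc + D * X₁ * e₆ - D * X₂ * e₅
    rcases eq_or_ne (p ^ a : ℤ) 0 with h0 | h0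
    · rw [h0, zero_mul] at hm hk
      exact ⟨0, 0, by simp [hm], by simp [hk], by simp⟩
    · generalize D * (Y₂ * c₅ - Y₁ * c₆) - m * c = m' at hm
      generalize D * (X₁ * c₆ - X₂ * c₅) - k * c = k' at hk
      refine ⟨m', k', hm, hk, ?_⟩
      rw [hm, hk, hpow, mul_assoc, mul_assoc, ← mul_add] at h₂
      exact (mul_dvd_mul_iff_left h0).1 h₂
  · rintro ⟨m', k', rfl, rfl, hd⟩
    refine ⟨⟨m' * X₁ + k' * Y₁, by ring⟩, ?_⟩
    rw [hpow, mul_assoc, mul_assoc, ← mul_add]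
    exact mul_dvd_mul_left _ hd

theorem pairRelations_eq_iff (hp : p.Prime) (hab : a ≤ b) {X₁ X₂ Y₁ Y₂ X₁' X₂' Y₁' Y₂' : ℤ}
    (h : AddSubgroup.closure ({((X₁ : ZMod (p ^ a)), (X₂ : ZMod (p ^ b))),
      ((Y₁ : ZMod (p ^ a)), (Y₂ : ZMod (p ^ b)))} : Set (ZMod (p ^ a) × ZMod (p ^ b))) = ⊤)
    (h' : AddSubgroup.closure ({((X₁' : ZMod (p ^ a)), (X₂' : ZMod (p ^ b))),
      ((Y₁' : ZMod (p ^ a)), (Y₂' : ZMod (p ^ b)))} : Set (ZMod (p ^ a) × ZMod (p ^ b))) = ⊤) :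
    pairRelations ((X₁ : ZMod (p ^ a)), (X₂ : ZMod (p ^ b)))
        ((Y₁ : ZMod (p ^ a)), (Y₂ : ZMod (p ^ b))) =
      pairRelations ((X₁' : ZMod (p ^ a)), (X₂' : ZMod (p ^ b)))
        ((Y₁' : ZMod (p ^ a)), (Y₂' : ZMod (p ^ b))) ↔
      ∀ m k : ℤ, (p ^ (b - a) : ℤ) ∣ m * X₂ + k * Y₂ ↔ (p ^ (b - a) : ℤ) ∣ m * X₂' + k * Y₂' := by
  have h0 : (p ^ a : ℤ) ≠ 0 := pow_ne_zero _ (mod_cast hp.ne_zero)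
  constructor
  · intro H m k
    have := Set.ext_iff.1 H (p ^ a * m, p ^ a * k)
    rw [mem_pairRelations_iff hab h, mem_pairRelations_iff hab h'] at this
    simpa [h0] using this
  · intro H
    ext ⟨m, k⟩
    rw [mem_pairRelations_iff hab h, mem_pairRelations_iff hab h']
    simp only [H]

theorem closure_zero_one_pair_eq_top (t : ℤ) :
    AddSubgroup.closure ({(((0 : ℤ) : ZMod (p ^ a)), ((1 : ℤ) : ZMod (p ^ b))),
      (((1 : ℤ) : ZMod (p ^ a)), (t : ZMod (p ^ b)))} : Set (ZMod (p ^ a) × ZMod (p ^ b))) = ⊤ := by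
  rw [eq_top_iff]
  rintro z -
  obtain ⟨Z₁, Z₂, rfl⟩ := exists_intCast_pair z
  exact AddSubgroup.mem_closure_pair.2 ⟨Z₂ - t * Z₁, Z₁,
    zsmul_add_zsmul_intCast_eq_iff.2 ⟨⟨0, by ring⟩, ⟨0, by ring⟩⟩⟩

theorem exists_bezout_of_closure_eq_top {X₁ X₂ Y₁ Y₂ : ℤ}
    (h : AddSubgroup.closure ({((X₁ : ZMod (p ^ a)), (X₂ : ZMod (p ^ b))),
      ((Y₁ : ZMod (p ^ a)), (Y₂ : ZMod (p ^ b)))} : Set (ZMod (p ^ a) × ZMod (p ^ b))) = ⊤) :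
    ∃ u v : ℤ, (p ^ b : ℤ) ∣ u * X₂ + v * Y₂ - 1 := by
  have hz := h ▸ AddSubgroup.mem_top (((0 : ℤ) : ZMod (p ^ a)), ((1 : ℤ) : ZMod (p ^ b)))
  obtain ⟨u, v, huv⟩ := AddSubgroup.mem_closure_pair.1 hz
  exact ⟨u, v, (zsmul_add_zsmul_intCast_eq_iff.1 huv).2⟩

end Relations

/-- A row `(X, Y)` with `X` invertible modulo `N` has the same relations modulo `N` as a
row `(1, t)`. -/
theorem exists_normalized_row {N : ℕ} (hN : 0 < N) {X : ℤ} (hX : IsCoprime X N) (Y : ℤ) :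
    ∃ t < N, (N : ℤ) ∣ X * t - Y ∧
      ∀ m k : ℤ, (N : ℤ) ∣ m * X + k * Y ↔ (N : ℤ) ∣ m + k * t := by
  obtain ⟨u, v, huv⟩ := hX
  have hN' : (N : ℤ) ≠ 0 := by positivity
  obtain ⟨t, ht⟩ := Int.eq_ofNat_of_zero_le (Int.emod_nonneg (u * Y) hN')
  have hlt : t < N := by
    have := Int.emod_lt_of_pos (u * Y) (by positivity : (0 : ℤ) < N)
    omega
  have hdiv := Int.emod_add_mul_ediv (u * Y) N
  rw [ht] at hdiv
  have hXt : (N : ℤ) ∣ X * t - Y :=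
    ⟨-(v * Y) - X * (u * Y / N), by linear_combination X * hdiv + Y * huv⟩
  refine ⟨t, hlt, hXt, fun m k => ?_⟩
  have hcop : IsCoprime (N : ℤ) X := ⟨v, u, by linear_combination huv⟩
  have hcancel : (N : ℤ) ∣ X * (m + k * t) ↔ (N : ℤ) ∣ m + k * t :=
    ⟨hcop.dvd_of_dvd_mul_left, fun h => h.mul_left X⟩
  rw [← hcancel]
  obtain ⟨c, hc⟩ := hXt
  have : X * (m + k * t) = (m * X + k * Y) + N * (k * c) := by linear_combination k * hc
  rw [this, dvd_add_left (dvd_mul_right _ _)]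


/-- The number of orbits of `Aut(G)` on generating pairs of
`G = ℤ_{p^a} ⊕ ℤ_{p^b}` (`0 ≤ a ≤ b`, `p` prime) equals the Dedekind totient
`ψ(p^{b−a})`, i.e. `1` if `a = b` and `p^{b−a} + p^{b−a−1}` if `a < b`. -/
theorem stmt12 (p a b : ℕ) (hp : p.Prime) (hab : a ≤ b) :
    Nat.card (Quot (fun x y : {q : (ZMod (p ^ a) × ZMod (p ^ b)) ×
          (ZMod (p ^ a) × ZMod (p ^ b)) //
          AddSubgroup.closure ({q.1, q.2} : Set (ZMod (p ^ a) × ZMod (p ^ b))) = ⊤} =>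
        ∃ σ : AddAut (ZMod (p ^ a) × ZMod (p ^ b)),
          σ x.1.1 = y.1.1 ∧ σ x.1.2 = y.1.2)) =
      if a = b then 1 else p ^ (b - a) + p ^ (b - a - 1) := by
  set P := ZMod (p ^ a) × ZMod (p ^ b)
  set r := fun x y : {q : P × P // AddSubgroup.closure ({q.1, q.2} : Set P) = ⊤} =>
    ∃ σ : AddAut P, σ x.1.1 = y.1.1 ∧ σ x.1.2 = y.1.2
  have mk_eq : ∀ x y, Quot.mk r x = Quot.mk r y ↔
      pairRelations x.1.1 x.1.2 = pairRelations y.1.1 y.1.2 := by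
    have hiff : ∀ x y, r x y ↔ pairRelations x.1.1 x.1.2 = pairRelations y.1.1 y.1.2 :=
      fun x y => exists_addAut_iff_pairRelations_eq x.2 y.2
    intro x y
    exact ⟨congrArg (Quot.lift (fun z => pairRelations z.1.1 z.1.2) fun u v => (hiff u v).1),
      fun h => Quot.sound ((hiff x y).2 h)⟩
  have swap : ∀ t : ℤ, AddSubgroup.closure ({(((1 : ℤ) : ZMod (p ^ a)), (t : ZMod (p ^ b))),
      (((0 : ℤ) : ZMod (p ^ a)), ((1 : ℤ) : ZMod (p ^ b)))} : Set P) = ⊤ := fun t => by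
    rw [Set.pair_comm]; exact closure_zero_one_pair_eq_top t
  have mk_int : ∀ {X₁ X₂ Y₁ Y₂ X₁' X₂' Y₁' Y₂' : ℤ}
      (h : AddSubgroup.closure ({((X₁ : ZMod (p ^ a)), (X₂ : ZMod (p ^ b))),
        ((Y₁ : ZMod (p ^ a)), (Y₂ : ZMod (p ^ b)))} : Set P) = ⊤)
      (h' : AddSubgroup.closure ({((X₁' : ZMod (p ^ a)), (X₂' : ZMod (p ^ b))),
        ((Y₁' : ZMod (p ^ a)), (Y₂' : ZMod (p ^ b)))} : Set P) = ⊤),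
      Quot.mk r ⟨(_, _), h⟩ = Quot.mk r ⟨(_, _), h'⟩ ↔ ∀ m k : ℤ,
        (p ^ (b - a) : ℤ) ∣ m * X₂ + k * Y₂ ↔ (p ^ (b - a) : ℤ) ∣ m * X₂' + k * Y₂' :=
    fun h h' => (mk_eq _ _).trans (pairRelations_eq_iff hp hab h h')
  clear_value r
  let f : Fin (p ^ (b - a)) ⊕ Fin (p ^ (b - a - 1)) →
      {q : P × P // AddSubgroup.closure ({q.1, q.2} : Set P) = ⊤} :=
    Sum.elim (fun t => ⟨(_, _), closure_zero_one_pair_eq_top (t : ℤ)⟩)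
      (fun s => ⟨(_, _), swap (p * s : ℤ)⟩)
  split_ifs with hEq
  · rw [Nat.card_eq_one_iff_unique]
    refine ⟨⟨?_⟩, ⟨Quot.mk r ⟨(_, _), closure_zero_one_pair_eq_top 0⟩⟩⟩
    rintro ⟨⟨x, y⟩, h⟩ ⟨⟨x', y'⟩, h'⟩
    obtain ⟨X₁, X₂, rfl⟩ := exists_intCast_pair x
    obtain ⟨Y₁, Y₂, rfl⟩ := exists_intCast_pair y
    obtain ⟨X₁', X₂', rfl⟩ := exists_intCast_pair x'
    obtain ⟨Y₁', Y₂', rfl⟩ := exists_intCast_pair y'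
    refine (mk_int h h').2 ?_
    simp [hEq]
  · obtain ⟨n, hn⟩ : ∃ n, b - a = n + 1 := ⟨b - a - 1, by omega⟩
    have hp1 : ¬ (p : ℤ) ∣ 1 := fun h =>
      hp.one_lt.ne' (by exact_mod_cast Int.eq_one_of_dvd_one (by positivity) h)
    have hpp : (p : ℤ) ∣ p ^ (b - a) := hn ▸ dvd_pow_self _ n.succ_ne_zero
    have hN : 0 < p ^ (b - a) := pow_pos hp.pos _
    have lt_eq : ∀ {N s t : ℕ}, s < N → t < N → (N : ℤ) ∣ t - s → s = t := fun hs ht h =>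
      Nat.ModEq.eq_of_lt_of_lt ((Nat.modEq_iff_dvd).2 h) hs ht
    have hbij : Function.Bijective (fun i => Quot.mk r (f i)) := by
      constructor
      · rintro (t | s) (t' | s') h
        · have h := (mk_int (closure_zero_one_pair_eq_top (t : ℤ))
            (closure_zero_one_pair_eq_top (t' : ℤ))).1 h
          have := (h (-t) 1).1 (by simp)
          congr 1
          exact Fin.ext (lt_eq t.2 t'.2 (by push_cast; convert this using 1; ring))
        · have h := (mk_int (closure_zero_one_pair_eq_top (t : ℤ)) (swap (p * s' : ℤ))).1 h
          have := hpp.trans ((h 1 (-(p * s'))).2 (by simp))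
          obtain ⟨c, hc⟩ := this
          exact (hp1 ⟨c + s' * t, by linear_combination hc⟩).elim
        · have h := (mk_int (swap (p * s : ℤ)) (closure_zero_one_pair_eq_top (t' : ℤ))).1 h
          have := hpp.trans ((h 1 (-(p * s))).1 (by simp))
          obtain ⟨c, hc⟩ := this
          exact (hp1 ⟨c + s * t', by linear_combination hc⟩).elim
        · have h := (mk_int (swap (p * s : ℤ)) (swap (p * s' : ℤ))).1 h
          have := (h 1 (-(p * s))).1 (by simp)
          congr 1
          refine Fin.ext (lt_eq s.2 s'.2 ?_)
          have h0 : (p : ℤ) ≠ 0 := mod_cast hp.ne_zero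
          obtain ⟨c, hc⟩ := this
          have hpow : (p : ℤ) ^ (b - a) = p * p ^ (b - a - 1) := by
            rw [hn, pow_succ', Nat.add_sub_cancel]
          rw [hpow] at hc
          exact ⟨c, mul_left_cancel₀ h0 (by push_cast; linear_combination hc)⟩
      · rintro ⟨⟨x, y⟩, h⟩
        obtain ⟨X₁, X₂, rfl⟩ := exists_intCast_pair x
        obtain ⟨Y₁, Y₂, rfl⟩ := exists_intCast_pair y
        have hcop : ∀ Z : ℤ, ¬ (p : ℤ) ∣ Z → IsCoprime Z (p ^ (b - a) : ℕ) := fun Z hZ => by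
          push_cast
          exact (((Nat.prime_iff_prime_int.1 hp).coprime_iff_not_dvd).2 hZ).symm.pow_right
        by_cases hX : (p : ℤ) ∣ X₂
        · have hY : ¬ (p : ℤ) ∣ Y₂ := by
            intro hY
            obtain ⟨u, v, huv⟩ := exists_bezout_of_closure_eq_top h
            have hpb : (p : ℤ) ∣ p ^ b := dvd_pow_self _ (by omega)
            exact hp1 ((dvd_sub_right ((hX.mul_left u).add (hY.mul_left v))).1 (hpb.trans huv))
          obtain ⟨t, ht, htX, hrow⟩ := exists_normalized_row hN (hcop _ hY) X₂
          have hpt : (p : ℤ) ∣ t := by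
            have h1 : (p : ℤ) ∣ Y₂ * t := by
              have := hpp.trans (by exact_mod_cast htX)
              exact (dvd_sub_left hX).1 this
            exact ((Nat.prime_iff_prime_int.1 hp).dvd_or_dvd h1).resolve_left hY
          obtain ⟨s, rfl⟩ := Int.natCast_dvd_natCast.1 hpt
          have hs : s < p ^ (b - a - 1) := by
            rw [hn, pow_succ'] at ht
            simpa [hn] using lt_of_mul_lt_mul_left ht (Nat.zero_le p)
          refine ⟨Sum.inr ⟨s, hs⟩, (mk_int (swap _) h).2 fun m k => ?_⟩
          have := hrow k m
          push_cast at this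
          rw [add_comm (m * X₂), this, mul_one, add_comm k]
        · obtain ⟨t, ht, -, hrow⟩ := exists_normalized_row hN (hcop _ hX) Y₂
          refine ⟨Sum.inl ⟨t, ht⟩, (mk_int (closure_zero_one_pair_eq_top _) h).2 fun m k => ?_⟩
          have := hrow m k
          push_cast at this
          rw [this, mul_one]
    rw [← Nat.card_congr (Equiv.ofBijective _ hbij)]
    simp
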